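/- For the fractional Brownian motion kernel K_H(t,s) = c_H{ (t/s)^{H−1/2}(t−s)^{H−1/2} − (H−1/2) s^{1/2−H} ∫_s^t u^{H−3/2}(u−s)^{H−1/2} du } with c_H = √(2HΓ(3/2−H)/(Γ(1/2+H)Γ(2−2H))), the identity ∫_0^{min(t,s)} K_H(t,u) K_H(s,u) du = (1/2)(t^{2H} + s^{2H} − |t−s|^{2H}) holds for all t, s > 0 and H ∈ (0,1). -/

import Mathlib

open MeasureTheory Real

/-- Normalizing constant of the fBm Volterra kernel. -/
noncomputable def cH (H : ℝ) : ℝ :=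
  Real.sqrt (2 * H * Real.Gamma (3 / 2 - H) /
    (Real.Gamma (1 / 2 + H) * Real.Gamma (2 - 2 * H)))

/-- The fBm Volterra kernel `K_H(t,s)`, defined for `0 < s < t` and `0` otherwise. -/
noncomputable def KH (H t s : ℝ) : ℝ :=
  if 0 < s ∧ s < t then
    cH H * ((t / s) ^ (H - 1 / 2) * (t - s) ^ (H - 1 / 2) -
      (H - 1 / 2) * s ^ (1 / 2 - H) *
        ∫ u in Set.Ioc s t, u ^ (H - 3 / 2) * (u - s) ^ (H - 1 / 2))
  else 0


/-- coefficients of (1-u)^b -/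
noncomputable def fq (b : ℝ) : ℕ → ℝ
  | 0 => 1
  | n + 1 => fq b n * (n - b) / (n + 1)

lemma fq_eq (b : ℝ) (n : ℕ) : fq b n = (-1) ^ n * Ring.choose b n := by
  induction n with
  | zero => simp [fq]
  | succ n ih =>
    rw [fq, ih]
    have h := Ring.descPochhammer_eq_factorial_smul_choose b (n+1)
    have h' := Ring.descPochhammer_eq_factorial_smul_choose b n
    rw [descPochhammer_succ_right] at h
    simp only [Polynomial.smeval_mul, Polynomial.smeval_sub, Polynomial.smeval_X, h'] at h
    simp [Polynomial.smeval_natCast, Nat.factorial_succ] at h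
    have hf : (n.factorial : ℝ) ≠ 0 := by positivity
    have h2 : Ring.choose b n * (b - n) = (n+1) * Ring.choose b (n+1) := by
      apply mul_left_cancel₀ hf
      linarith
    have : (n:ℝ) + 1 ≠ 0 := by positivity
    field_simp
    rw [pow_succ]
    linear_combination (-(-1)^n) * h2

lemma hasSum_fq (b u : ℝ) (hu : |u| < 1) : HasSum (fun n => fq b n * u ^ n) ((1 - u) ^ b) := by
  have h := (Real.one_add_rpow_hasFPowerSeriesOnBall_zero (a := b)).hasSum (y := -u)
    (by simpa [enorm_eq_nnnorm, ← NNReal.coe_lt_coe] using hu)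
  simp at h
  have e : (1 - u) = 1 + -u := by ring
  rw [e]
  have e2 : (fun n => fq b n * u ^ n) = fun n => (-u) ^ n * (binomialSeries ℝ b).coeff n := by
    funext n
    rw [fq_eq, neg_pow]
    simp [binomialSeries]
    ring
  rw [e2]
  exact h

lemma summable_fq (b : ℝ) (hb : 0 < b) : Summable (fun n => |fq b n|) := by
  obtain ⟨N, hN⟩ := exists_nat_gt b
  rw [← summable_nat_add_iff N]
  have key : ∀ n, ∑ i ∈ Finset.range n, |fq b (i + N)| ≤ (N * |fq b N| - (n + N) * |fq b (n + N)|) / b := by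
    intro n
    induction n with
    | zero => simp
    | succ n ih =>
      rw [Finset.sum_range_succ, le_div_iff₀ hb]
      rw [le_div_iff₀ hb] at ih
      have e : n + 1 + N = (n + N) + 1 := by ring
      have h1 : |fq b (n + 1 + N)| = |fq b (n+N)| * (n + N - b) / (n + N + 1) := by
        rw [e, fq, abs_div, abs_mul]
        have h0 : (0:ℝ) ≤ n := by positivity
        push_cast
        rw [abs_of_nonneg (by linarith : (0:ℝ) ≤ n + N - b), abs_of_pos (by positivity : (0:ℝ) < n + N + 1)]
      rw [h1]
      have : (n:ℝ) + N + 1 ≠ 0 := by positivity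
      push_cast
      have e2 : ((n:ℝ) + 1 + N) * (|fq b (n + N)| * (n + N - b) / (n + N + 1)) = |fq b (n + N)| * (n + N - b) := by
        field_simp; ring
      rw [e2]
      nlinarith
  refine summable_of_sum_range_le (c := N * |fq b N| / b) (fun n => abs_nonneg _) fun n => (key n).trans ?_
  gcongr
  have : 0 ≤ ((n:ℝ) + N) * |fq b (n + N)| := by positivity
  linarith

lemma hasSum_fq_one (b s : ℝ) (hb : 0 < b) (hs : 0 < s) (hs1 : s ≤ 1) :
    HasSum (fun n => fq b n * s ^ n) ((1 - s) ^ b) := by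
  have hsum : ∀ x ∈ Set.Icc (0:ℝ) 1, ∀ n, ‖fq b n * x ^ n‖ ≤ |fq b n| := by
    intro x hx n
    rw [norm_mul, norm_pow, Real.norm_eq_abs, Real.norm_eq_abs, abs_of_nonneg hx.1]
    exact mul_le_of_le_one_right (abs_nonneg _) (pow_le_one₀ hx.1 hx.2)
  have hc : ContinuousOn (fun x : ℝ => ∑' n, fq b n * x ^ n) (Set.Icc 0 1) :=
    continuousOn_tsum (fun n => by fun_prop) (summable_fq b hb) (fun n x hx => hsum x hx n)
  have hc2 : ContinuousOn (fun x : ℝ => (1 - x) ^ b) (Set.Icc 0 1) := by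
    apply ContinuousOn.rpow_const (by fun_prop)
    intro x hx; right; exact hb.le
  have heq : Set.EqOn (fun x : ℝ => ∑' n, fq b n * x ^ n) (fun x : ℝ => (1 - x) ^ b) (Set.Icc 0 1) := by
    have h0 : Set.EqOn (fun x : ℝ => ∑' n, fq b n * x ^ n) (fun x : ℝ => (1 - x) ^ b) (Set.Ico 0 1) := by
      intro x hx
      exact (hasSum_fq b x (by rw [abs_of_nonneg hx.1]; exact hx.2)).tsum_eq
    refine h0.of_subset_closure hc hc2 Set.Ico_subset_Icc_self ?_
    rw [closure_Ico (by norm_num)]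
  have := heq ⟨hs.le, hs1⟩
  simp only at this
  rw [← this]
  exact (Summable.of_norm_bounded (summable_fq b hb) (hsum s ⟨hs.le, hs1⟩)).hasSum

lemma beta_int (p q : ℝ) (hp : -1 < p) (hq : -1 < q) :
    IntervalIntegrable (fun x : ℝ => x ^ p * (1 - x) ^ q) volume 0 1 ∧
    ∫ x in (0:ℝ)..1, x ^ p * (1 - x) ^ q = ProbabilityTheory.beta (p + 1) (q + 1) := by
  have h := Complex.betaIntegral_convergent (u := ((p + 1 : ℝ) : ℂ)) (v := ((q + 1 : ℝ) : ℂ))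
    (by simp; linarith) (by simp; linarith)
  have key : ∀ x ∈ Set.Ioc (0:ℝ) 1, ((x : ℂ) ^ (((p + 1 : ℝ) : ℂ) - 1) * (1 - (x : ℂ)) ^ (((q + 1 : ℝ) : ℂ) - 1)) = ((x ^ p * (1 - x) ^ q : ℝ) : ℂ) := by
    intro x hx
    have e1 : (((p + 1 : ℝ) : ℂ) - 1) = (p : ℂ) := by push_cast; ring
    have e2 : (((q + 1 : ℝ) : ℂ) - 1) = (q : ℂ) := by push_cast; ring
    rw [e1, e2, Complex.ofReal_mul, Complex.ofReal_cpow hx.1.le, Complex.ofReal_cpow (by linarith [hx.2])]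
    push_cast; rfl
  have hi : IntervalIntegrable (fun x : ℝ => ((x ^ p * (1 - x) ^ q : ℝ) : ℂ)) volume 0 1 := by
    refine h.congr ?_
    intro x hx
    rw [Set.uIoc_of_le (by norm_num)] at hx
    exact key x hx
  constructor
  · have := hi.1.re
    rw [intervalIntegrable_iff_integrableOn_Ioc_of_le (by norm_num)]
    simpa [IntegrableOn] using this
  · rw [ProbabilityTheory.beta_eq_betaIntegralReal _ _ (by linarith) (by linarith), Complex.betaIntegral]
    rw [intervalIntegral.integral_congr_ae (g := fun x : ℝ => ((x ^ p * (1 - x) ^ q : ℝ) : ℂ))]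
    · rw [intervalIntegral.integral_ofReal, Complex.ofReal_re]
    · refine Filter.Eventually.of_forall fun x hx => ?_
      rw [Set.uIoc_of_le (by norm_num)] at hx
      exact key x hx

lemma beta_succ_right (p q : ℝ) (hp : 0 < p) (hq : 0 < q) :
    ProbabilityTheory.beta p (q + 1) = ProbabilityTheory.beta p q * q / (p + q) := by
  unfold ProbabilityTheory.beta
  rw [← add_assoc, Real.Gamma_add_one hq.ne', Real.Gamma_add_one (by positivity)]
  have := (Real.Gamma_pos_of_pos (add_pos hp hq)).ne'
  field_simp

lemma beta_succ_left (p q : ℝ) (hp : 0 < p) (hq : 0 < q) :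
    ProbabilityTheory.beta (p + 1) q = ProbabilityTheory.beta p q * p / (p + q) := by
  unfold ProbabilityTheory.beta
  rw [add_right_comm, Real.Gamma_add_one hp.ne', Real.Gamma_add_one (by positivity)]
  have := (Real.Gamma_pos_of_pos (add_pos hp hq)).ne'
  field_simp

noncomputable def fL (a x : ℝ) : ℝ := ∫ w in x..1, w ^ (-2 * a) * (1 - w) ^ a

noncomputable def fphi (a u : ℝ) : ℝ :=
  (1 - u) ^ a - 1 / 2 * (1 - u) ^ (a + 1) + 1 / 2 * (1 - a) * u ^ (2 * a) * fL a u

section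
variable {a : ℝ} 

lemma fL_one : fL a 1 = 0 := by simp [fL]

lemma fL_int (h1 : -1/2 < a) (h2 : a < 1/2) : IntervalIntegrable (fun x : ℝ => x ^ (-2 * a) * (1 - x) ^ a) volume 0 1 :=
  (beta_int _ _ (by linarith) (by linarith)).1

lemma fL_zero (h1 : -1/2 < a) (h2 : a < 1/2) : fL a 0 = ProbabilityTheory.beta (1 - 2 * a) (a + 1) := by
  rw [fL, (beta_int _ _ (by linarith) (by linarith)).2]
  congr 1; ring

lemma fL_add (h1 : -1/2 < a) (h2 : a < 1/2) (x : ℝ) (hx : 0 ≤ x) (hx1 : x ≤ 1) :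
    (∫ w in (0:ℝ)..x, w ^ (-2 * a) * (1 - w) ^ a) + fL a x = fL a 0 := by
  have hi := fL_int h1 h2
  refine intervalIntegral.integral_add_adjacent_intervals (hi.mono_set ?_) (hi.mono_set ?_)
  · rw [Set.uIcc_of_le hx, Set.uIcc_of_le zero_le_one]; exact Set.Icc_subset_Icc_right hx1
  · rw [Set.uIcc_of_le hx1, Set.uIcc_of_le zero_le_one]; exact Set.Icc_subset_Icc_left hx

lemma fL_cont (h1 : -1/2 < a) (h2 : a < 1/2) : ContinuousOn (fL a) (Set.Icc 0 1) := by
  have hi := fL_int h1 h2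
  have := intervalIntegral.continuousOn_primitive_interval' hi (a := 0) (by simp)
  rw [Set.uIcc_of_le zero_le_one] at this
  refine ((continuousOn_const (c := fL a 0)).sub this).congr ?_
  intro x hx
  have := fL_add h1 h2 x hx.1 hx.2
  simp only [Pi.sub_apply]
  linarith

lemma fL_deriv (h1 : -1/2 < a) (h2 : a < 1/2) (x : ℝ) (hx : 0 < x) (hx1 : x < 1) :
    HasDerivAt (fL a) (-(x ^ (-2 * a) * (1 - x) ^ a)) x := by
  have hi := fL_int h1 h2
  refine intervalIntegral.integral_hasDerivAt_left (hi.mono_set ?_) ?_ ?_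
  · rw [Set.uIcc_of_le hx1.le, Set.uIcc_of_le zero_le_one]; exact Set.Icc_subset_Icc_left hx.le
  · have : ContinuousOn (fun x : ℝ => x ^ (-2 * a) * (1 - x) ^ a) (Set.Ioo 0 1) := by
      apply ContinuousOn.mul
      · exact ContinuousOn.rpow_const (by fun_prop) (fun y hy => Or.inl hy.1.ne')
      · exact ContinuousOn.rpow_const (by fun_prop) (fun y hy => Or.inl (sub_pos.2 hy.2).ne')
    exact this.stronglyMeasurableAtFilter isOpen_Ioo x ⟨hx, hx1⟩
  · apply ContinuousAt.mul
    · exact ContinuousAt.rpow_const (by fun_prop) (Or.inl hx.ne')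
    · exact ContinuousAt.rpow_const (by fun_prop) (Or.inl (sub_pos.2 hx1).ne')

lemma fL_nonneg (x : ℝ) (hx : 0 ≤ x) (hx1 : x ≤ 1) : 0 ≤ fL a x := by
  apply intervalIntegral.integral_nonneg hx1
  intro w hw
  have := hw.1
  have := hw.2
  exact mul_nonneg (rpow_nonneg (by linarith) _) (rpow_nonneg (by linarith) _)

lemma fphi_nonneg (h2 : a < 1/2) (x : ℝ) (hx : 0 < x) (hx1 : x < 1) : 0 ≤ fphi a x := by
  have h3 := fL_nonneg (a := a) x hx.le hx1.le
  have h4 : (1 - x) ^ (a + 1) ≤ (1 - x) ^ a := rpow_le_rpow_of_exponent_ge (by linarith) (by linarith) (by linarith)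
  have h5 : 0 ≤ (1 - x) ^ a := rpow_nonneg (by linarith) _
  have h6 : 0 ≤ 1 / 2 * (1 - a) * x ^ (2 * a) * fL a x := by
    have : 0 ≤ 1 - a := by linarith
    positivity
  unfold fphi
  linarith

/-- Moments of the kernel. -/
lemma fphi_moment (h1 : -1/2 < a) (h2 : a < 1/2) (z : ℝ) (hz : -1 < z) (hz2 : -1 < z - 2 * a) :
    IntervalIntegrable (fun x : ℝ => x ^ (z - 2 * a) * fphi a x) volume 0 1 ∧
    ∫ x in (0:ℝ)..1, x ^ (z - 2 * a) * fphi a x =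
      ProbabilityTheory.beta (z - 2 * a + 1) (a + 1) * (z + 1 - a) / (z + 1) := by
  obtain ⟨i1, v1⟩ := beta_int (z - 2 * a) a hz2 (by linarith)
  obtain ⟨i2, v2⟩ := beta_int (z - 2 * a) (a + 1) hz2 (by linarith)
  obtain ⟨i3, v3⟩ := beta_int (z - 2 * a + 1) a (by linarith) (by linarith)
  have i4 : IntervalIntegrable (fun x : ℝ => x ^ z * fL a x) volume 0 1 := by
    apply (intervalIntegral.intervalIntegrable_rpow' hz).mul_continuousOn
    rw [Set.uIcc_of_le zero_le_one]
    exact fL_cont h1 h2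
  have v4 : ∫ x in (0:ℝ)..1, ((z + 1) * (x ^ z * fL a x) - x ^ (z - 2 * a + 1) * (1 - x) ^ a) = 0 := by
    have := intervalIntegral.integral_eq_sub_of_hasDerivAt_of_le (a := 0) (b := 1)
      (f := fun x : ℝ => x ^ (z + 1) * fL a x)
      (f' := fun x => (z + 1) * (x ^ z * fL a x) - x ^ (z - 2 * a + 1) * (1 - x) ^ a) zero_le_one ?_ ?_ ?_
    · rw [this, fL_one, zero_rpow (by linarith)]; ring
    · exact ContinuousOn.mul (ContinuousOn.rpow_const (by fun_prop) (fun _ _ => Or.inr (by linarith)))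
        (fL_cont h1 h2)
    · intro x hx
      have d1 := (Real.hasDerivAt_rpow_const (x := x) (p := z + 1) (Or.inl hx.1.ne')).mul
        (fL_deriv h1 h2 x hx.1 hx.2)
      refine HasDerivAt.congr_deriv d1 ?_
      have : x ^ (z - 2 * a + 1) = x ^ (z + 1) * x ^ (-2 * a) := by
        rw [← rpow_add hx.1]; congr 1; ring
      rw [this, show z + 1 - 1 = z by ring]; ring
    · exact (i4.const_mul _).sub i3
  rw [intervalIntegral.integral_sub (i4.const_mul _) i3, intervalIntegral.integral_const_mul, v3] at v4
  have hcongr : ∀ x ∈ Set.uIoc (0:ℝ) 1, (x ^ (z - 2 * a) * (1 - x) ^ a - 1 / 2 * (x ^ (z - 2 * a) * (1 - x) ^ (a + 1))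
      + 1 / 2 * (1 - a) * (x ^ z * fL a x)) = x ^ (z - 2 * a) * fphi a x := by
    intro x hx
    rw [Set.uIoc_of_le zero_le_one] at hx
    have : x ^ z = x ^ (z - 2 * a) * x ^ (2 * a) := by
      rw [← rpow_add hx.1]; congr 1; ring
    rw [this, fphi]; ring
  have i5 := (i1.sub (i2.const_mul (1/2))).add (i4.const_mul (1 / 2 * (1 - a)))
  refine ⟨i5.congr hcongr, ?_⟩
  rw [← intervalIntegral.integral_congr_ae (Filter.Eventually.of_forall hcongr)]
  rw [intervalIntegral.integral_add (i1.sub (i2.const_mul (1/2))) (i4.const_mul (1 / 2 * (1 - a))),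
    intervalIntegral.integral_sub i1 (i2.const_mul (1/2)), intervalIntegral.integral_const_mul,
    intervalIntegral.integral_const_mul, v1, v2]
  have hz1 : z + 1 ≠ 0 := by linarith
  have v5 : ∫ x in (0:ℝ)..1, x ^ z * fL a x = ProbabilityTheory.beta (z - 2 * a + 1 + 1) (a + 1) / (z + 1) := by
    field_simp; linarith
  rw [v5, beta_succ_right (z - 2 * a + 1) (a + 1) (by linarith) (by linarith),
    beta_succ_left (z - 2 * a + 1) (a + 1) (by linarith) (by linarith)]
  have hz3 : z - 2 * a + 1 + (a + 1) ≠ 0 := by linarith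
  field_simp
  ring

lemma int_kernel (h1 : -1/2 < a) (h2 : a < 1/2) (t u : ℝ) (hu : 0 < u) (hut : u < t) :
    a * ∫ v in Set.Ioc u t, v ^ (a - 1) * (v - u) ^ a =
      1 / 2 * t ^ (a - 1) * (t - u) ^ (a + 1) - 1 / 2 * (1 - a) * u ^ (2 * a) * fL a (u / t) := by
  have hii : IntervalIntegrable (fun v : ℝ => a * (v ^ (a - 1) * (v - u) ^ a)) volume u t := by
    apply IntervalIntegrable.const_mul
    apply IntervalIntegrable.continuousOn_mul
    · have := (intervalIntegral.intervalIntegrable_rpow' (a := 0) (b := t - u) (r := a) (by linarith)).comp_sub_right u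
      simpa using this
    · rw [Set.uIcc_of_le hut.le]
      exact ContinuousOn.rpow_const (by fun_prop) (fun y hy => Or.inl (by linarith [hy.1]))
  have := intervalIntegral.integral_eq_sub_of_hasDerivAt_of_le (a := u) (b := t)
      (f := fun v : ℝ => 1 / 2 * v ^ (a - 1) * (v - u) ^ (a + 1) - 1 / 2 * (1 - a) * u ^ (2 * a) * fL a (u / v))
      (f' := fun v => a * (v ^ (a - 1) * (v - u) ^ a)) hut.le ?_ ?_ hii
  · rw [← intervalIntegral.integral_of_le hut.le, ← intervalIntegral.integral_const_mul, this]
    rw [div_self hu.ne', fL_one, sub_self, zero_rpow (by linarith)]; ring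
  · apply ContinuousOn.sub
    · apply ContinuousOn.mul
      · exact continuousOn_const.mul (ContinuousOn.rpow_const (by fun_prop) (fun y hy => Or.inl (by linarith [hy.1])))
      · exact ContinuousOn.rpow_const (by fun_prop) (fun y hy => Or.inr (by linarith))
    · apply continuousOn_const.mul
      apply (fL_cont h1 h2).comp
      · exact continuousOn_const.div continuousOn_id (fun y hy => by linarith [hy.1])
      · intro y hy
        have hy0 : 0 < y := by linarith [hy.1]
        exact ⟨by positivity, by rw [div_le_one hy0]; exact hy.1⟩
  · intro v hv
    have hv0 : 0 < v := by linarith [hv.1]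
    have hvu : 0 < v - u := by linarith [hv.1]
    have dL : HasDerivAt (fun v => fL a (u / v)) (-((u / v) ^ (-2 * a) * (1 - u / v) ^ a) * (-u / v ^ 2)) v := by
      have d0 : HasDerivAt (fun v : ℝ => u / v) (-u / v ^ 2) v := by
        have := (hasDerivAt_const v u).div (hasDerivAt_id v) hv0.ne'
        refine HasDerivAt.congr_deriv this ?_
        simp
      exact HasDerivAt.comp v (fL_deriv h1 h2 (u / v) (by positivity) (by rw [div_lt_one hv0]; exact hv.1)) d0
    have dA := Real.hasDerivAt_rpow_const (x := v) (p := a - 1) (Or.inl hv0.ne')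
    have dB : HasDerivAt (fun v : ℝ => (v - u) ^ (a + 1)) ((a + 1) * (v - u) ^ a) v := by
      have := ((hasDerivAt_id v).sub_const u).rpow_const (p := a + 1) (Or.inl hvu.ne')
      refine HasDerivAt.congr_deriv this ?_
      simp
    have D := ((dA.const_mul (1 / 2)).mul dB).sub (dL.const_mul (1 / 2 * (1 - a) * u ^ (2 * a)))
    refine HasDerivAt.congr_deriv D ?_
    have e1 : (u / v) ^ (-2 * a) = v ^ (a - 1) * v ^ (a + 1) / u ^ (2 * a) := by
      rw [← rpow_add hv0, div_rpow hu.le hv0.le, neg_mul, rpow_neg hu.le, rpow_neg hv0.le]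
      rw [show a - 1 + (a + 1) = 2 * a by ring]
      field_simp
    have e2 : (1 - u / v) ^ a = (v - u) ^ a / (v ^ (a + 1) / v) := by
      rw [show 1 - u / v = (v - u) / v by field_simp, div_rpow hvu.le hv0.le, rpow_add_one hv0.ne']
      field_simp
    have e3 : (v - u) ^ (a + 1) = (v - u) ^ a * (v - u) := rpow_add_one hvu.ne' _
    have e4 : v ^ (a - 1) = v ^ (a - 1 - 1) * v := by
      rw [← rpow_add_one hv0.ne']; congr 1; ring
    have p1 : u ^ (2 * a) ≠ 0 := (rpow_pos_of_pos hu _).ne'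
    have p2 : v ^ (a + 1) ≠ 0 := (rpow_pos_of_pos hv0 _).ne'
    rw [e1, e2, e3, e4]
    field_simp
    ring

lemma KH_eq (h1 : -1/2 < a) (h2 : a < 1/2) (t u : ℝ) (hu : 0 < u) (hut : u < t) :
    KH (a + 1 / 2) t u = cH (a + 1 / 2) * t ^ a * ((u / t) ^ (-a) * fphi a (u / t)) := by
  have ht : 0 < t := by linarith
  have htu : 0 < t - u := by linarith
  rw [KH, if_pos ⟨hu, hut⟩]
  rw [show a + 1 / 2 - 1 / 2 = a by ring, show 1 / 2 - (a + 1 / 2) = -a by ring, show a + 1 / 2 - 3 / 2 = a - 1 by ring]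
  have := int_kernel h1 h2 t u hu hut
  rw [mul_right_comm a, this, fphi, show 1 - u / t = (t - u) / t by field_simp]
  have p1 : u ^ a ≠ 0 := (rpow_pos_of_pos hu _).ne'
  have p2 : t ^ a ≠ 0 := (rpow_pos_of_pos ht _).ne'
  rw [div_rpow htu.le ht.le, div_rpow htu.le ht.le, div_rpow hu.le ht.le, div_rpow hu.le ht.le, div_rpow ht.le hu.le,
    rpow_add_one ht.ne', rpow_add_one htu.ne', rpow_neg hu.le, rpow_neg ht.le, rpow_sub_one ht.ne']
  rw [show 2 * a = a + a by ring, rpow_add hu, rpow_add ht]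
  field_simp
  ring


lemma fq_shift (n : ℕ) : fq (a + 1) (n + 1) = - fq a n * (1 + a) / (n + 1) := by
  induction n with
  | zero => simp [fq]; ring
  | succ n ih =>
    rw [fq, ih, fq]
    push_cast
    have : (n:ℝ) + 1 ≠ 0 := by positivity
    have : (n:ℝ) + 1 + 1 ≠ 0 := by positivity
    field_simp
    ring

/-- Taylor coefficients of the regular part of the kernel. -/
noncomputable def fd (a : ℝ) : ℕ → ℝ
  | 0 => 1 / 2
  | n + 1 => fq a (n + 1) * (n + 1 - a) / (n + 1 - 2 * a)

lemma prim_series (h2 : a < 1/2) (u : ℝ) (hu : 0 < u) (hu1 : u < 1) :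
    HasSum (fun n : ℕ => fq a n / (n + 1 - 2 * a) * u ^ (n + 1))
      (u ^ (2 * a) * ∫ w in (0:ℝ)..u, w ^ (-2 * a) * (1 - w) ^ a) := by
  have hpos : ∀ n : ℕ, 1 - 2 * a ≤ n + 1 - 2 * a := fun n => by
    have : (0:ℝ) ≤ n := by positivity
    linarith
  have h12 : 0 < 1 - 2 * a := by linarith
  have hexp : ∀ n : ℕ, -1 < n - 2 * a := fun n => by linarith [hpos n]
  have hint : ∀ n : ℕ, IntervalIntegrable (fun w : ℝ => w ^ (n - 2 * a)) volume 0 u := fun n =>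
    intervalIntegral.intervalIntegrable_rpow' (hexp n)
  have hval : ∀ n : ℕ, ∫ w in Set.Ioc (0:ℝ) u, w ^ (n - 2 * a) = u ^ (n + 1) / (n + 1 - 2 * a) * u ^ (-2 * a) := fun n => by
    rw [← intervalIntegral.integral_of_le hu.le, integral_rpow (Or.inl (hexp n)), zero_rpow (by linarith [hexp n])]
    rw [show (n:ℝ) - 2 * a + 1 = ((n + 1 : ℕ) : ℝ) + (-2 * a) by push_cast; ring, rpow_add hu, rpow_natCast]
    push_cast
    rw [show (n:ℝ) + 1 + -2 * a = n + 1 - 2 * a by ring]; ring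
  have H := hasSum_integral_of_summable_integral_norm (μ := volume.restrict (Set.Ioc (0:ℝ) u))
    (F := fun (n : ℕ) (w : ℝ) => fq a n * w ^ (n - 2 * a)) (fun n => (hint n).1.const_mul _) ?_
  · simp only [integral_const_mul, hval] at H
    have e : ∫ w in Set.Ioc (0:ℝ) u, ∑' n : ℕ, fq a n * w ^ (n - 2 * a) = ∫ w in (0:ℝ)..u, w ^ (-2 * a) * (1 - w) ^ a := by
      rw [intervalIntegral.integral_of_le hu.le]
      refine setIntegral_congr_fun measurableSet_Ioc fun w hw => ?_
      have := (hasSum_fq a w (by rw [abs_of_pos hw.1]; linarith [hw.2])).mul_left (w ^ (-2 * a))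
      rw [← this.tsum_eq]
      congr 1
      funext n
      rw [show (n:ℝ) - 2 * a = -2 * a + n by ring, rpow_add hw.1, rpow_natCast]; ring
    rw [e] at H
    have := H.mul_left (u ^ (2 * a))
    refine HasSum.congr_fun this ?_
    intro n
    have : u ^ (2 * a) * u ^ (-2 * a) = 1 := by rw [← rpow_add hu]; simp
    linear_combination (-(fq a n / (n + 1 - 2 * a) * u ^ (n + 1))) * this
  · have e : ∀ n : ℕ, ∫ w in Set.Ioc (0:ℝ) u, ‖fq a n * w ^ (n - 2 * a)‖ = |fq a n| * (u ^ (n + 1) / (n + 1 - 2 * a) * u ^ (-2 * a)) := by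
      intro n
      rw [← hval, ← integral_const_mul]
      refine setIntegral_congr_fun measurableSet_Ioc fun w hw => ?_
      simp only [norm_mul, Real.norm_eq_abs]
      rw [abs_of_nonneg (rpow_nonneg hw.1.le _)]
    simp only [e]
    have hs := ((hasSum_fq a u (by rw [abs_of_pos hu]; exact hu1)).summable.abs).mul_left (u / (1 - 2 * a) * u ^ (-2 * a))
    refine Summable.of_nonneg_of_le (fun n => ?_) (fun n => ?_) hs
    · have : 0 ≤ (n:ℝ) + 1 - 2 * a := by linarith [hpos n]
      positivity
    · rw [abs_mul, abs_of_pos (pow_pos hu n)]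
      have : u ^ (n + 1) / (n + 1 - 2 * a) ≤ u ^ (n + 1) / (1 - 2 * a) := by
        exact div_le_div_of_nonneg_left (by positivity) h12 (hpos n)
      calc _ ≤ |fq a n| * (u ^ (n + 1) / (1 - 2 * a) * u ^ (-2 * a)) := by gcongr
        _ = _ := by rw [pow_succ]; ring

lemma fphi_series (h1 : -1/2 < a) (h2 : a < 1/2) (u : ℝ) (hu : 0 < u) (hu1 : u < 1) :
    HasSum (fun n : ℕ => fd a n * u ^ n)
      (fphi a u - 1 / 2 * (1 - a) * fL a 0 * u ^ (2 * a)) := by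
  have hab : |u| < 1 := by rw [abs_of_pos hu]; exact hu1
  have A := hasSum_fq a u hab
  have B := hasSum_fq (a + 1) u hab
  have P := prim_series h2 u hu hu1
  have A' := (hasSum_nat_add_iff' 1).2 A
  have B' := (hasSum_nat_add_iff' 1).2 B
  simp [fq] at A' B'
  rw [← hasSum_nat_add_iff' 1]
  have S := (A'.sub (B'.mul_left (1/2))).sub (P.mul_left (1 / 2 * (1 - a)))
  have ev : fphi a u - 1 / 2 * (1 - a) * fL a 0 * u ^ (2 * a) - ∑ i ∈ Finset.range 1, fd a i * u ^ i
     = (1 - u) ^ a - 1 - 1 / 2 * ((1 - u) ^ (a + 1) - 1) - 1 / 2 * (1 - a) * (u ^ (2 * a) * ∫ w in (0:ℝ)..u, w ^ (-2 * a) * (1 - w) ^ a) := by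
    have := fL_add h1 h2 u hu.le hu1.le
    rw [← this, fphi]
    simp [fd]; ring
  rw [ev]
  refine HasSum.congr_fun S ?_
  intro n
  have e2 := fq_shift (a := a) n
  rw [fq] at e2
  rw [e2, fd, fq]
  have : (n:ℝ) + 1 ≠ 0 := by positivity
  have : (n:ℝ) + 1 - 2 * a ≠ 0 := by
    have : (0:ℝ) ≤ n := by positivity
    linarith
  have : (n:ℝ) + 1 - a * 2 ≠ 0 := by rwa [mul_comm a]
  field_simp
  ring

noncomputable def fM (a : ℝ) (n : ℕ) : ℝ := ProbabilityTheory.beta (n - 2 * a + 1) (a + 1) * (n + 1 - a) / (n + 1)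

lemma fM_succ (h1 : -1/2 < a) (h2 : a < 1/2) (n : ℕ) :
    fM a (n + 1) = fM a n * ((n + 1 - 2 * a) * (n + 1)) / ((n + 1 - a) * (n + 2)) := by
  have h0 : (0:ℝ) ≤ n := by positivity
  unfold fM
  push_cast
  rw [show (n:ℝ) + 1 - 2 * a + 1 = (n - 2 * a + 1) + 1 by ring,
    beta_succ_left (n - 2 * a + 1) (a + 1) (by linarith) (by linarith)]
  have : (n:ℝ) - 2 * a + 1 + (a + 1) ≠ 0 := by linarith
  have : (n:ℝ) + 1 - a ≠ 0 := by linarith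
  have : (n:ℝ) + 1 + 1 ≠ 0 := by linarith
  have : (n:ℝ) + 2 ≠ 0 := by linarith
  field_simp
  ring

lemma fd_fM (h1 : -1/2 < a) (h2 : a < 1/2) (n : ℕ) :
    fd a n * fM a n = -(1 / 2 * (1 - a) * fL a 0 / (2 * a + 1)) * fq (2 * a + 1) (n + 1) := by
  have hH : 2 * a + 1 ≠ 0 := by linarith
  have z : fd a 0 * fM a 0 = -(1 / 2 * (1 - a) * fL a 0 / (2 * a + 1)) * fq (2 * a + 1) (0 + 1) := by
    rw [fL_zero h1 h2]
    simp [fd, fM, fq]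
    rw [show -(2 * a) + 1 = 1 - 2 * a by ring]
    field_simp
    ring
  induction n with
  | zero => exact z
  | succ n ih =>
    rw [fM_succ h1 h2, fq]
    have h0 : (0:ℝ) ≤ n := by positivity
    have : (n:ℝ) + 1 - a ≠ 0 := by linarith
    have : (n:ℝ) + 2 ≠ 0 := by linarith
    have : (n:ℝ) + 1 - 2 * a ≠ 0 := by linarith
    have hd : fd a (n + 1) = fd a n * ((n + 1 - a) * (n - 2 * a)) / ((n + 1) * (n + 1 - 2 * a)) := by
      cases n with
      | zero => 
        simp [fd, fq]
        simp at this
        field_simp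
      | succ m =>
        rw [fd, fd, fq]
        push_cast at *
        have : (m:ℝ) + 1 - 2 * a ≠ 0 := by
          have : (0:ℝ) ≤ m := by positivity
          linarith
        have : (m:ℝ) + 1 - a * 2 ≠ 0 := by rwa [mul_comm a]
        have : (m:ℝ) + 1 + 1 - a * 2 ≠ 0 := by rwa [mul_comm a]
        field_simp
        try ring
    rw [hd]
    push_cast
    rw [show (n:ℝ) + 1 - (2 * a + 1) = n - 2 * a by ring]
    have : (n:ℝ) + 1 + 1 ≠ 0 := by linarith
    have : (n:ℝ) + 1 - a * 2 ≠ 0 := by rwa [mul_comm a]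
    calc _ = fd a n * fM a n * ((n - 2 * a) / (n + 2)) := by field_simp
      _ = _ := by
        rw [ih]; rw [show (n:ℝ) + 1 + 1 = n + 2 by ring]; ring


set_option maxHeartbeats 800000 in
lemma main_int (h1 : -1/2 < a) (h2 : a < 1/2) (r : ℝ) (hr : 0 < r) (hr1 : r ≤ 1) :
    ∫ x in (0:ℝ)..1, ((r * x) ^ (-a) * fphi a (r * x)) * (x ^ (-a) * fphi a x) =
      r ^ (-a - 1) * (1 / 2 * (1 - a) * fL a 0 / (2 * a + 1)) *
        (r ^ (2 * a + 1) + 1 - (1 - r) ^ (2 * a + 1)) := by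
  set κ := 1 / 2 * (1 - a) * fL a 0 with hκ
  have hH : 0 < 2 * a + 1 := by linarith
  obtain ⟨i0, v0⟩ := fphi_moment h1 h2 (2 * a) (by linarith) (by linarith)
  have v0' : ∫ x in (0:ℝ)..1, x ^ (2 * a - 2 * a) * fphi a x = 1 / (2 * a + 1) := by
    rw [v0, sub_self, zero_add, ProbabilityTheory.beta, add_comm 1 (a + 1), Real.Gamma_add_one (s := a + 1) (by linarith),
      Real.Gamma_one]
    have : Real.Gamma (a + 1) ≠ 0 := (Real.Gamma_pos_of_pos (by linarith)).ne'
    have : a + 1 ≠ 0 := by linarith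
    field_simp
    ring
  have hM : ∀ n : ℕ, IntervalIntegrable (fun x : ℝ => x ^ (n - 2 * a) * fphi a x) volume 0 1 ∧
      ∫ x in (0:ℝ)..1, x ^ (n - 2 * a) * fphi a x = fM a n := fun n => by
    have h0 : (0:ℝ) ≤ n := by positivity
    exact fphi_moment h1 h2 n (by linarith) (by linarith)
  -- the terms
  let G : ℕ → ℝ → ℝ := fun n => match n with
    | 0 => fun x => κ * r ^ a * (x ^ (2 * a - 2 * a) * fphi a x)
    | n + 1 => fun x => fd a n * r ^ n * r ^ (-a) * (x ^ (n - 2 * a) * fphi a x)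
  have hGi : ∀ n, Integrable (G n) (volume.restrict (Set.Ioo (0:ℝ) 1)) := by
    intro n
    have key : ∀ f : ℝ → ℝ, IntervalIntegrable f volume 0 1 → Integrable f (volume.restrict (Set.Ioo (0:ℝ) 1)) :=
      fun f hf => by
        rw [intervalIntegrable_iff_integrableOn_Ioo_of_le zero_le_one] at hf
        exact hf
    cases n with
    | zero => exact key _ (i0.const_mul _)
    | succ n => exact key _ ((hM n).1.const_mul _)
  have hconv : ∀ f : ℝ → ℝ, ∫ x in Set.Ioo (0:ℝ) 1, f x = ∫ x in (0:ℝ)..1, f x := fun f => by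
    rw [intervalIntegral.integral_of_le zero_le_one, integral_Ioc_eq_integral_Ioo]
  have hGs : ∀ n : ℕ, ∫ x in Set.Ioo (0:ℝ) 1, G (n + 1) x = fd a n * r ^ n * r ^ (-a) * fM a n := fun n => by
    rw [hconv, ← (hM n).2, ← intervalIntegral.integral_const_mul]
  have hG0 : ∫ x in Set.Ioo (0:ℝ) 1, G 0 x = κ * r ^ a * (1 / (2 * a + 1)) := by
    rw [hconv, ← v0', ← intervalIntegral.integral_const_mul]
  have hGn : ∀ n : ℕ, ∫ x in Set.Ioo (0:ℝ) 1, ‖G (n + 1) x‖ = |fd a n * fM a n| * r ^ n * r ^ (-a) := fun n => by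
    have e : ∫ x in Set.Ioo (0:ℝ) 1, ‖G (n + 1) x‖ = ∫ x in Set.Ioo (0:ℝ) 1, |fd a n| * r ^ n * r ^ (-a) * (x ^ (n - 2 * a) * fphi a x) := by
      refine setIntegral_congr_fun measurableSet_Ioo fun x hx => ?_
      have p1 := fphi_nonneg h2 x hx.1 hx.2
      have p2 : 0 ≤ x ^ (n - 2 * a) := rpow_nonneg hx.1.le _
      have p3 : 0 ≤ r ^ (-a) := rpow_nonneg hr.le _
      simp only [G, norm_mul, Real.norm_eq_abs]
      rw [abs_of_nonneg p1, abs_of_nonneg p2, abs_of_nonneg p3, abs_of_nonneg (pow_nonneg hr.le n)]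
    have hMn : 0 ≤ fM a n := by
      rw [← (hM n).2, ← hconv]
      refine setIntegral_nonneg measurableSet_Ioo fun x hx => ?_
      exact mul_nonneg (rpow_nonneg hx.1.le _) (fphi_nonneg h2 x hx.1 hx.2)
    rw [e, hconv, intervalIntegral.integral_const_mul, (hM n).2, abs_mul, abs_of_nonneg hMn]; ring
  have hsum : Summable fun n => ∫ x in Set.Ioo (0:ℝ) 1, ‖G n x‖ := by
    rw [← summable_nat_add_iff 1]
    simp only [hGn]
    apply Summable.mul_right
    have hs := ((summable_nat_add_iff 1).2 (summable_fq (2 * a + 1) hH)).mul_left |κ / (2 * a + 1)|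
    refine Summable.of_nonneg_of_le (fun n => by positivity) (fun n => ?_) hs
    rw [fd_fM h1 h2, abs_mul, abs_neg]
    exact mul_le_of_le_one_right (by positivity) (pow_le_one₀ hr.le hr1)
  have H := hasSum_integral_of_summable_integral_norm hGi hsum
  have H2 : HasSum (fun n => ∫ x in Set.Ioo (0:ℝ) 1, G n x) (κ * r ^ a * (1 / (2 * a + 1)) +
      (-(κ / (2 * a + 1)) * r ^ (-a - 1)) * ((1 - r) ^ (2 * a + 1) - 1)) := by
    rw [← hG0]
    apply HasSum.zero_add
    have Q := (hasSum_nat_add_iff' 1).2 (hasSum_fq_one (2 * a + 1) r hH hr hr1)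
    have Q2 := Q.mul_left (-(κ / (2 * a + 1)) * r ^ (-a - 1))
    simp only [Finset.range_one, Finset.sum_singleton, pow_zero, mul_one] at Q2
    rw [show fq (2 * a + 1) 0 = 1 from rfl] at Q2
    refine HasSum.congr_fun Q2 ?_
    intro n
    rw [hGs]
    have e := fd_fM h1 h2 n
    rw [← hκ] at e
    have e2 : r ^ (-a) = r ^ (-a - 1) * r := by
      rw [← rpow_add_one hr.ne']; congr 1; ring
    rw [e2, pow_succ]
    linear_combination (r ^ n * (r ^ (-a - 1) * r)) * e
  have H3 := H.unique H2
  have e3 : ∫ x in Set.Ioo (0:ℝ) 1, ∑' n, G n x = ∫ x in (0:ℝ)..1, ((r * x) ^ (-a) * fphi a (r * x)) * (x ^ (-a) * fphi a x) := by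
    rw [← hconv]
    refine setIntegral_congr_fun measurableSet_Ioo fun x hx => ?_
    have hx0 : 0 < x := hx.1
    have hrx : 0 < r * x := by positivity
    have hrx1 : r * x < 1 := by nlinarith [hx.2]
    have S := (fphi_series h1 h2 (r * x) hrx hrx1).mul_left ((r * x) ^ (-a) * (x ^ (-a) * fphi a x))
    rw [← hκ] at S
    have S2 : HasSum (fun n => G (n + 1) x) ((r * x) ^ (-a) * (x ^ (-a) * fphi a x) * (fphi a (r * x) - κ * (r * x) ^ (2 * a))) := by
      refine HasSum.congr_fun S ?_
      intro n
      simp only [G]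
      rw [show (n:ℝ) - 2 * a = n + (-a + -a) by ring, rpow_add hx0, rpow_add hx0, rpow_natCast,
        mul_rpow hr.le hx0.le, mul_pow]
      ring
    have S3 := (HasSum.zero_add (f := fun n => G n x) S2).tsum_eq
    refine S3.trans ?_
    simp only [G]
    have e4 : (r * x) ^ (-a) * x ^ (-a) * (r * x) ^ (2 * a) = r ^ a * x ^ (2 * a - 2 * a) := by
      rw [mul_rpow hr.le hx0.le, mul_rpow hr.le hx0.le]
      rw [show r ^ (-a) * x ^ (-a) * x ^ (-a) * (r ^ (2 * a) * x ^ (2 * a)) = (r ^ (-a) * r ^ (2 * a)) * (x ^ (-a) * x ^ (-a) * x ^ (2 * a)) by ring,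
        ← rpow_add hr, ← rpow_add hx0, ← rpow_add hx0]
      congr 2 <;> ring
    linear_combination (-κ * fphi a x) * e4
  rw [← e3, H3]
  have e5 : r ^ a = r ^ (-a - 1) * r ^ (2 * a + 1) := by
    rw [← rpow_add hr]; congr 1; ring
  rw [e5]
  ring

lemma cH_sq (h1 : -1/2 < a) (h2 : a < 1/2) :
    cH (a + 1 / 2) ^ 2 * (1 / 2 * (1 - a) * fL a 0 / (2 * a + 1)) = 1 / 2 := by
  have g1 : 0 < Real.Gamma (1 - a) := Real.Gamma_pos_of_pos (by linarith)
  have g2 : 0 < Real.Gamma (a + 1) := Real.Gamma_pos_of_pos (by linarith)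
  have g3 : 0 < Real.Gamma (1 - 2 * a) := Real.Gamma_pos_of_pos (by linarith)
  have hH : 0 < 2 * a + 1 := by linarith
  rw [cH, fL_zero h1 h2, ProbabilityTheory.beta]
  rw [show 3 / 2 - (a + 1 / 2) = 1 - a by ring, show 1 / 2 + (a + 1 / 2) = a + 1 by ring,
    show 2 - 2 * (a + 1 / 2) = 1 - 2 * a by ring, show 1 - 2 * a + (a + 1) = (1 - a) + 1 by ring,
    Real.Gamma_add_one (s := 1 - a) (by linarith), show 2 * (a + 1 / 2) = 2 * a + 1 by ring]
  rw [Real.sq_sqrt (by positivity)]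
  have : 1 - a ≠ 0 := by linarith
  have g4 : Real.Gamma (1 - a * 2) ≠ 0 := by rw [mul_comm a]; exact g3.ne'
  field_simp

lemma cov_le (h1 : -1/2 < a) (h2 : a < 1/2) (t s : ℝ) (hs : 0 < s) (hst : s ≤ t) :
    ∫ u in Set.Ioc 0 s, KH (a + 1 / 2) t u * KH (a + 1 / 2) s u =
      (1 / 2) * (t ^ (2 * a + 1) + s ^ (2 * a + 1) - (t - s) ^ (2 * a + 1)) := by
  have ht : 0 < t := by linarith
  have hr : 0 < s / t := by positivity
  have hr1 : s / t ≤ 1 := by rw [div_le_one ht]; exact hst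
  set c := cH (a + 1 / 2) with hc
  let g : ℝ → ℝ := fun x => c ^ 2 * t ^ a * s ^ a * (((s / t * x) ^ (-a) * fphi a (s / t * x)) * (x ^ (-a) * fphi a x))
  have e1 : ∫ u in Set.Ioc 0 s, KH (a + 1 / 2) t u * KH (a + 1 / 2) s u =
      ∫ u in (0:ℝ)..s, g (u / s) := by
    rw [intervalIntegral.integral_of_le hs.le, integral_Ioc_eq_integral_Ioo, integral_Ioc_eq_integral_Ioo]
    refine setIntegral_congr_fun measurableSet_Ioo fun u hu => ?_
    simp only [g]
    rw [KH_eq h1 h2 t u hu.1 (lt_of_lt_of_le hu.2 hst), KH_eq h1 h2 s u hu.1 hu.2,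
      show s / t * (u / s) = u / t by field_simp]
    ring
  rw [e1, intervalIntegral.integral_comp_div g hs.ne', zero_div, div_self hs.ne']
  simp only [g]
  rw [intervalIntegral.integral_const_mul, main_int h1 h2 _ hr hr1]
  have e2 := cH_sq h1 h2
  rw [← hc] at e2
  rw [show 1 - s / t = (t - s) / t by field_simp, div_rpow (show 0 ≤ t - s by linarith) ht.le, div_rpow hs.le ht.le,
    div_rpow hs.le ht.le]
  have p1 : 0 < t ^ (2 * a + 1) := rpow_pos_of_pos ht _
  have e3 : s ^ a * s * s ^ (-a - 1) = 1 := by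
    rw [← rpow_add_one hs.ne', ← rpow_add hs]; simp
  have e4 : t ^ a / t ^ (-a - 1) = t ^ (2 * a + 1) := by
    rw [← rpow_sub ht]; congr 1; ring
  rw [smul_eq_mul]
  have p2 : t ^ (-a - 1) ≠ 0 := (rpow_pos_of_pos ht _).ne'
  calc _ = (c ^ 2 * (1 / 2 * (1 - a) * fL a 0 / (2 * a + 1))) * (s ^ a * s * s ^ (-a - 1)) * (t ^ a / t ^ (-a - 1)) *
      (s ^ (2 * a + 1) / t ^ (2 * a + 1) + 1 - (t - s) ^ (2 * a + 1) / t ^ (2 * a + 1)) := by ring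
    _ = _ := by
      rw [e2, e3, e4]
      field_simp
      ring

end

/-- the fBm Volterra kernel reproduces the fBm covariance:
`∫_0^{min t s} K_H(t,u) K_H(s,u) du = (1/2)(t^{2H} + s^{2H} - |t-s|^{2H})`
for all `t, s > 0` and `H ∈ (0,1)`. -/
theorem fbm_kernel_covariance (H : ℝ) (hH : H ∈ Set.Ioo (0 : ℝ) 1)
    (t s : ℝ) (ht : 0 < t) (hs : 0 < s) :
    ∫ u in Set.Ioc 0 (min t s), KH H t u * KH H s u =
      (1 / 2) * (t ^ (2 * H) + s ^ (2 * H) - |t - s| ^ (2 * H)) := by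
  obtain ⟨a, rfl⟩ : ∃ a, H = a + 1 / 2 := ⟨H - 1 / 2, by ring⟩
  have h1 : -1/2 < a := by linarith [hH.1]
  have h2 : a < 1/2 := by linarith [hH.2]
  rw [show 2 * (a + 1 / 2) = 2 * a + 1 by ring]
  rcases le_total s t with h | h
  · rw [min_eq_right h, abs_of_nonneg (by linarith), cov_le h1 h2 t s hs h]
  · rw [min_eq_left h, abs_of_nonpos (by linarith), neg_sub]
    have := cov_le h1 h2 s t ht h
    simp only [mul_comm (KH (a + 1 / 2) s _)] at this
    rw [this]
    ring
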